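/- Let G be a finite abelian group of exponent n = q_1^{α_1} ⋯ q_ℓ^{α_ℓ} with q_1 < ⋯ < q_ℓ prime, and let S be a sequence over G containing no tiny zero-sum subsequence. For each i, let A_i = {d ∣ n : d > 1 and P^+(d) = q_i}, and for d ∈ A_i let k_d be the smallest non-negative integer such that |S_d| < k_d · d/q_i^{ν_{q_i}(d)} + η_{(d/q_i^{ν_{q_i}(d)}, d)}(G), where S_d is the subsequence of S consisting of all elements of order d. Then for all i ∈ {1,…,ℓ}, Σ_{d ∈ A_i} k_d ≤ t(G_{q_i^{ν_{q_i}(n)}}) − 1. -/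

import Mathlib

open Multiset Finset

/-- The cross number of a sequence (multiset) over an additive group:
    the sum of the reciprocals of the orders of its elements. -/
noncomputable def crossNum {G : Type*} [AddCommGroup G] (S : Multiset G) : ℝ :=
  (S.map fun g => (1 : ℝ) / (addOrderOf g : ℝ)).sum

/-- A tiny zero-sum sequence: non-empty, zero sum, cross number at most 1. -/
def IsTinyZS {G : Type*} [AddCommGroup G] (S' : Multiset G) : Prop :=
  S' ≠ 0 ∧ S'.sum = 0 ∧ crossNum S' ≤ 1

/-- `tC G` : the smallest `t ≥ 1` such that every sequence over `G` of length `≥ t`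
    contains a tiny zero-sum subsequence. -/
noncomputable def tC (G : Type*) [AddCommGroup G] : ℕ :=
  sInf {t : ℕ | 0 < t ∧ ∀ S : Multiset G, t ≤ Multiset.card S → ∃ S' ≤ S, IsTinyZS S'}

/-- `etaC G` : the smallest `t ≥ 1` such that every sequence over `G` of length `≥ t`
    contains a non-empty zero-sum subsequence of length at most `exp(G)`. -/
noncomputable def etaC (G : Type*) [AddCommGroup G] : ℕ :=
  sInf {t : ℕ | 0 < t ∧ ∀ S : Multiset G, t ≤ Multiset.card S →
    ∃ S' ≤ S, S' ≠ 0 ∧ S'.sum = 0 ∧ Multiset.card S' ≤ AddMonoid.exponent G}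

/-- `etaDD G d' d` : the smallest `t ≥ 1` such that every sequence over
    `G_d = {x : G | d • x = 0}` of length `≥ t` contains a non-empty subsequence of length
    at most `d'` whose sum lies in `G_{d/d'}`. -/
noncomputable def etaDD (G : Type*) [AddCommGroup G] (d' d : ℕ) : ℕ :=
  sInf {t : ℕ | 0 < t ∧ ∀ S : Multiset G, (∀ g ∈ S, d • g = 0) → t ≤ Multiset.card S →
    ∃ S' ≤ S, S' ≠ 0 ∧ Multiset.card S' ≤ d' ∧ (d / d') • S'.sum = 0}

/-- `rhoC G` : the maximum of the cross numbers of sequences over `G` containing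
    no tiny zero-sum subsequence. -/
noncomputable def rhoC (G : Type*) [AddCommGroup G] : ℝ :=
  sSup {x : ℝ | ∃ S : Multiset G, (¬ ∃ S' ≤ S, IsTinyZS S') ∧ crossNum S = x}

/-- `maxPF n = P⁺(n)`, the greatest prime divisor of `n`, with `P⁺(1) = 1`. -/
def maxPF (n : ℕ) : ℕ := if n = 1 then 1 else n.primeFactors.sup id

/-- `G` is a finite abelian group of rank `r`, i.e. `G ≅ C_{n₁} ⊕ ⋯ ⊕ C_{n_r}` with
    `1 < n₁ ∣ ⋯ ∣ n_r`. -/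
def HasRank (G : Type*) [AddCommGroup G] (r : ℕ) : Prop :=
  ∃ n : Fin r → ℕ, (∀ i, 1 < n i) ∧ (∀ i j : Fin r, i ≤ j → n i ∣ n j) ∧
    Nonempty (G ≃+ ((i : Fin r) → ZMod (n i)))


/-- The subgroup `G_m = {x : G | m • x = 0}` of elements of order dividing `m`. -/
def torsionSub (G : Type*) [AddCommGroup G] (m : ℕ) : AddSubgroup G where
  carrier := {x : G | m • x = 0}
  zero_mem' := by simp
  add_mem' := by
    intro a b ha hb
    simp only [Set.mem_setOf_eq, smul_add] at *
    rw [ha, hb, add_zero]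
  neg_mem' := by
    intro a ha
    simp only [Set.mem_setOf_eq, smul_neg] at *
    rw [ha, neg_zero]

theorem crossNum_zero {G : Type*} [AddCommGroup G] : crossNum (0 : Multiset G) = 0 := by
  simp [crossNum]

theorem crossNum_add {G : Type*} [AddCommGroup G] (S T : Multiset G) :
    crossNum (S + T) = crossNum S + crossNum T := by
  simp [crossNum]

/-- A submultiset of an image is the image of a submultiset. -/
theorem exists_le_map_eq_of_le_map {α β : Type*} (f : α → β) (P : Multiset α) :
    ∀ T ≤ P.map f, ∃ P' ≤ P, P'.map f = T := by
  classical
  induction P using Multiset.induction_on with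
  | empty =>
    intro T hT
    exact ⟨0, le_rfl, (Multiset.le_zero.1 hT).symm⟩
  | cons a P ih =>
    intro T hT
    rw [Multiset.map_cons] at hT
    by_cases ha : f a ∈ T
    · obtain ⟨U, rfl⟩ := Multiset.exists_cons_of_mem ha
      obtain ⟨P', hP', rfl⟩ := ih U ((Multiset.cons_le_cons_iff _).1 hT)
      exact ⟨a ::ₘ P', Multiset.cons_le_cons a hP', Multiset.map_cons f a P'⟩
    · obtain ⟨P', hP', rfl⟩ := ih T ((Multiset.le_cons_of_notMem ha).1 hT)
      exact ⟨P', hP'.trans (Multiset.le_cons_self P a), rfl⟩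

/-- Pigeonhole: a long enough sequence over a finite type repeats some element `k` times. -/
theorem exists_replicate_le_of_card_mul_lt {α : Type*} [Fintype α] (S : Multiset α) (k : ℕ)
    (hS : Fintype.card α * k < Multiset.card S) : ∃ a, Multiset.replicate k a ≤ S := by
  classical
  by_contra! h
  have hcount : ∀ a, S.count a ≤ k := fun a =>
    (not_le.1 fun hk => h a (Multiset.le_count_iff_replicate_le.1 hk)).le
  have hcard : Multiset.card S = ∑ a : α, S.count a :=
    (Multiset.sum_count_eq_card fun a _ => Finset.mem_univ a).symm
  have := Finset.sum_le_card_nsmul Finset.univ (fun a => S.count a) k fun a _ => hcount a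
  rw [Finset.card_univ, smul_eq_mul] at this
  omega

/-- In a finite group the set defining `tC` is non-empty, so its infimum is attained. -/
theorem tC_spec (G : Type*) [AddCommGroup G] [Fintype G] :
    0 < tC G ∧ ∀ S : Multiset G, tC G ≤ Multiset.card S → ∃ S' ≤ S, IsTinyZS S' := by
  refine Nat.sInf_mem (s := {t : ℕ | 0 < t ∧ ∀ S : Multiset G, t ≤ Multiset.card S →
    ∃ S' ≤ S, IsTinyZS S'})
    ⟨Fintype.card G * Fintype.card G + 1, Nat.succ_pos _, fun S hS => ?_⟩
  obtain ⟨a, ha⟩ := exists_replicate_le_of_card_mul_lt S (Fintype.card G) hS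
  have hpos : 0 < addOrderOf a := addOrderOf_pos a
  refine ⟨Multiset.replicate (addOrderOf a) a,
    ((Multiset.replicate_le_replicate a).2 addOrderOf_le_card_univ).trans ha, ?_, ?_, ?_⟩
  · rw [← Multiset.card_pos, Multiset.card_replicate]
    exact hpos
  · rw [Multiset.sum_replicate, addOrderOf_nsmul_eq_zero]
  · have : (addOrderOf a : ℝ) ≠ 0 := by positivity
    simp [crossNum, this]

/-- In a finite group the set defining `etaDD` is non-empty, so its infimum is attained. -/
theorem etaDD_spec (G : Type*) [AddCommGroup G] [Fintype G] {d' d : ℕ} (hd' : 0 < d')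
    (h : d' ∣ d) (S : Multiset G) (hS : ∀ g ∈ S, d • g = 0)
    (hcard : etaDD G d' d ≤ Multiset.card S) :
    ∃ S' ≤ S, S' ≠ 0 ∧ Multiset.card S' ≤ d' ∧ (d / d') • S'.sum = 0 := by
  refine (Nat.sInf_mem (s := {t : ℕ | 0 < t ∧ ∀ S : Multiset G, (∀ g ∈ S, d • g = 0) →
    t ≤ Multiset.card S → ∃ S' ≤ S, S' ≠ 0 ∧ Multiset.card S' ≤ d' ∧ (d / d') • S'.sum = 0})
    ⟨Fintype.card G * d' + 1, Nat.succ_pos _, fun S hS hc => ?_⟩).2 S hS hcard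
  obtain ⟨a, ha⟩ := exists_replicate_le_of_card_mul_lt S d' hc
  refine ⟨Multiset.replicate d' a, ha, ?_, by simp, ?_⟩
  · rw [← Multiset.card_pos, Multiset.card_replicate]
    exact hd'
  · rw [Multiset.sum_replicate, smul_smul, Nat.div_mul_cancel h]
    exact hS a (Multiset.mem_of_le ha (Multiset.mem_replicate.2 ⟨hd'.ne', rfl⟩))

/-- Greedy extraction of `k` disjoint subsequences of length at most `d'` with sum in
`G_{d/d'}`. -/
theorem exists_disjoint_subsequences (G : Type*) [AddCommGroup G] [Fintype G] {d' d : ℕ}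
    (hd' : 0 < d') (h : d' ∣ d) (k : ℕ) (S : Multiset G) (hS : ∀ g ∈ S, d • g = 0)
    (hcard : ∀ j < k, j * d' + etaDD G d' d ≤ Multiset.card S) :
    ∃ P : Multiset (Multiset G), Multiset.card P = k ∧ P.sum ≤ S ∧
      ∀ X ∈ P, X ≠ 0 ∧ Multiset.card X ≤ d' ∧ (d / d') • X.sum = 0 := by
  classical
  induction k generalizing S with
  | zero => exact ⟨0, by simp⟩
  | succ k ih =>
    obtain ⟨X, hXS, hX⟩ := etaDD_spec G hd' h S hS (by simpa using hcard 0 k.succ_pos)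
    obtain ⟨P, hPk, hPS, hP⟩ := ih (S - X)
      (fun g hg => hS g (Multiset.mem_of_le (Multiset.sub_le_self S X) hg)) (fun j hj => by
        have := hcard (j + 1) (by omega)
        rw [Multiset.card_sub hXS]
        rw [add_mul] at this
        omega)
    refine ⟨X ::ₘ P, by simp [hPk], ?_, fun Y hY => ?_⟩
    · rw [Multiset.sum_cons, ← add_tsub_cancel_of_le hXS]
      exact add_le_add_right hPS X
    · rcases Multiset.mem_cons.1 hY with rfl | hY
      exacts [hX, hP Y hY]

/-- Subsequences of elements of pairwise distinct orders are jointly a subsequence. -/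
theorem sum_filter_addOrderOf_le {G : Type*} [AddCommGroup G] (S : Multiset G) (A : Finset ℕ) :
    ∑ d ∈ A, S.filter (fun g => addOrderOf g = d) ≤ S := by
  classical
  rw [Multiset.le_iff_count]
  intro g
  rw [Multiset.count_sum']
  simp only [Multiset.count_filter, Finset.sum_ite_eq]
  split_ifs <;> simp

theorem crossNum_le_of_addOrderOf_eq {G : Type*} [AddCommGroup G] (X : Multiset G) {d m e : ℕ}
    (hX : ∀ g ∈ X, addOrderOf g = d) (hcard : Multiset.card X ≤ m) (hm : 0 < m)
    (hd : d = e * m) (he : 0 < e) (hsum : e • X.sum = 0) :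
    crossNum X ≤ 1 / (addOrderOf X.sum : ℝ) := by
  have hval : crossNum X = Multiset.card X * (1 / (d : ℝ)) := by
    rw [crossNum, Multiset.map_congr rfl fun g hg => by rw [hX g hg]]
    simp
  have hdvd := addOrderOf_dvd_of_nsmul_eq_zero hsum
  have hpos : 0 < addOrderOf X.sum := Nat.pos_of_dvd_of_pos hdvd he
  have hle : (addOrderOf X.sum : ℝ) ≤ e := by exact_mod_cast Nat.le_of_dvd he hdvd
  have hcard' : (Multiset.card X : ℝ) ≤ m := by exact_mod_cast hcard
  calc crossNum X ≤ m * (1 / (d : ℝ)) := by rw [hval]; gcongr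
    _ = 1 / (e : ℝ) := by
      rw [hd]
      push_cast
      field_simp
    _ ≤ _ := by gcongr

/-- If the terms of a family of subsequences of `S` have sums in a subgroup `H`, with cross
numbers at most those of their sums, then a family of at least `tC H` terms yields a tiny
zero-sum subsequence. -/
theorem exists_isTinyZS_of_tC_le_card {G : Type*} [AddCommGroup G] [Fintype G]
    (H : AddSubgroup G) (S : Multiset G) (P : Multiset (Multiset G)) (hPS : P.sum ≤ S)
    (hne : ∀ X ∈ P, X ≠ 0) (hH : ∀ X ∈ P, X.sum ∈ H)
    (hcross : ∀ X ∈ P, crossNum X ≤ 1 / (addOrderOf X.sum : ℝ))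
    (hcard : tC H ≤ Multiset.card P) : ∃ S' ≤ S, IsTinyZS S' := by
  classical
  let f : Multiset G → H := fun X => if h : X.sum ∈ H then ⟨X.sum, h⟩ else 0
  have hf : ∀ X ∈ P, (f X : G) = X.sum := fun X hX => by simp [f, hH X hX]
  obtain ⟨T, hT, hT0, hTsum, hTcross⟩ := (tC_spec H).2 (P.map f) (by simpa using hcard)
  obtain ⟨Q, hQ, rfl⟩ := exists_le_map_eq_of_le_map f P T hT
  have key : ∀ R : Multiset (Multiset G), R ≤ P →
      R.sum.sum = ((R.map f).sum : G) ∧ crossNum R.sum ≤ crossNum (R.map f) := by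
    intro R
    induction R using Multiset.induction_on with
    | empty => simp [crossNum_zero]
    | cons X R ih =>
      intro hR
      obtain ⟨h1, h2⟩ := ih ((Multiset.le_cons_self R X).trans hR)
      have hX : X ∈ P := Multiset.mem_of_le hR (Multiset.mem_cons_self X R)
      refine ⟨by simp [h1, hf X hX], ?_⟩
      have h3 : crossNum (f X ::ₘ R.map f) =
          1 / (addOrderOf X.sum : ℝ) + crossNum (R.map f) := by
        rw [crossNum, Multiset.map_cons, Multiset.sum_cons, ← AddSubgroup.addOrderOf_coe,
          hf X hX, crossNum]
      rw [Multiset.sum_cons, crossNum_add, Multiset.map_cons, h3]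
      exact add_le_add (hcross X hX) h2
  obtain ⟨hsum, hle⟩ := key Q hQ
  obtain ⟨R, rfl⟩ := Multiset.le_iff_exists_add.1 hQ
  refine ⟨Q.sum, le_trans (by simp) hPS, fun h0 => ?_, by rw [hsum, hTsum]; rfl,
    hle.trans hTcross⟩
  obtain ⟨X, hX⟩ := Multiset.exists_mem_of_ne_zero (fun hQ0 : Q = 0 => hT0 (by simp [hQ0]))
  exact hne X (Multiset.mem_add.2 (Or.inl hX))
    (le_antisymm (h0 ▸ Multiset.single_le_sum (fun _ _ => Multiset.zero_le _) X hX)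
      (Multiset.zero_le X))

/-- Let `G` have exponent `n` and let `S` contain no tiny zero-sum subsequence. For a prime
`q ∣ n`, summing over all divisors `d > 1` of `n` with `P⁺(d) = q` the quantity `k_d`,
defined as the smallest `k` with `|S_d| < k·d/q^{ν_q(d)} + η_{(d/q^{ν_q(d)}, d)}(G)`,
one gets `∑_{d ∈ A_q} k_d ≤ t(G_{q^{ν_q(n)}}) - 1`. -/
theorem stmt12 (G : Type*) [AddCommGroup G] [Fintype G]
    (n : ℕ) (hn : AddMonoid.exponent G = n)
    (S : Multiset G) (hS : ¬ ∃ S' ≤ S, IsTinyZS S')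
    (q : ℕ) (hq : q.Prime) (hqn : q ∣ n) :
    ∑ d ∈ n.divisors.filter (fun d => 1 < d ∧ maxPF d = q),
      sInf {k : ℕ | Multiset.card (S.filter (fun g => addOrderOf g = d)) <
        k * (d / q ^ d.factorization q) + etaDD G (d / q ^ d.factorization q) d}
      ≤ tC (torsionSub G (q ^ n.factorization q)) - 1 := by
  classical
  set A := n.divisors.filter (fun d => 1 < d ∧ maxPF d = q)
  have hA : ∀ d ∈ A, d ∣ n ∧ n ≠ 0 := fun d hd =>
    Nat.mem_divisors.1 (Finset.mem_filter.1 hd).1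
  have hpart : ∀ d ∈ A, 0 < d / q ^ d.factorization q ∧
      d = q ^ d.factorization q * (d / q ^ d.factorization q) := fun d hd =>
    ⟨Nat.ordCompl_pos q (ne_zero_of_dvd_ne_zero (hA d hd).2 (hA d hd).1),
      (Nat.ordProj_mul_ordCompl_eq_self d q).symm⟩
  have hquot : ∀ d ∈ A, d / (d / q ^ d.factorization q) = q ^ d.factorization q :=
    fun d hd => Nat.div_eq_of_eq_mul_left (hpart d hd).1 (hpart d hd).2
  have hex : ∀ d ∈ A, ∃ P : Multiset (Multiset G),
      Multiset.card P = sInf {k : ℕ | Multiset.card (S.filter (fun g => addOrderOf g = d)) <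
        k * (d / q ^ d.factorization q) + etaDD G (d / q ^ d.factorization q) d} ∧
      P.sum ≤ S.filter (fun g => addOrderOf g = d) ∧
      ∀ X ∈ P, X ≠ 0 ∧ Multiset.card X ≤ d / q ^ d.factorization q ∧
        (d / (d / q ^ d.factorization q)) • X.sum = 0 := fun d hd =>
    exists_disjoint_subsequences G (hpart d hd).1 (Dvd.intro_left _ (hpart d hd).2.symm) _ _
      (fun g hg => by rw [← (Multiset.mem_filter.1 hg).2, addOrderOf_nsmul_eq_zero])
      (fun j hj => not_lt.1 fun hlt => Nat.notMem_of_lt_sInf hj hlt)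
  choose! P hPcard hPsum hP using hex
  have hpos := (tC_spec (torsionSub G (q ^ n.factorization q))).1
  rw [← Finset.sum_congr rfl hPcard, ← Multiset.card_sum]
  refine Nat.le_sub_one_of_lt (not_le.1 fun hle => hS ?_)
  refine exists_isTinyZS_of_tC_le_card (torsionSub G (q ^ n.factorization q)) S (∑ d ∈ A, P d)
    ?_ ?_ ?_ ?_ hle
  · rw [Multiset.sum_sum]
    exact (Finset.sum_le_sum hPsum).trans (sum_filter_addOrderOf_le S A)
  · intro X hX
    obtain ⟨d, hd, hXd⟩ := Multiset.mem_sum.1 hX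
    exact (hP d hd X hXd).1
  · intro X hX
    obtain ⟨d, hd, hXd⟩ := Multiset.mem_sum.1 hX
    have h0 := (hP d hd X hXd).2.2
    rw [hquot d hd] at h0
    obtain ⟨c, hc⟩ : q ^ d.factorization q ∣ q ^ n.factorization q :=
      Nat.pow_dvd_pow q ((Nat.factorization_le_iff_dvd
        (ne_zero_of_dvd_ne_zero (hA d hd).2 (hA d hd).1) (hA d hd).2).2 (hA d hd).1 q)
    change q ^ n.factorization q • X.sum = 0
    rw [hc, mul_comm, mul_smul, h0, smul_zero]
  · intro X hX
    obtain ⟨d, hd, hXd⟩ := Multiset.mem_sum.1 hX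
    obtain ⟨-, hcard, h0⟩ := hP d hd X hXd
    rw [hquot d hd] at h0
    refine crossNum_le_of_addOrderOf_eq X (fun g hg => ?_) hcard (hpart d hd).1
      (hpart d hd).2 (pow_pos hq.pos _) h0
    exact (Multiset.mem_filter.1 (Multiset.mem_of_le
      ((Multiset.single_le_sum (fun _ _ => Multiset.zero_le _) X hXd).trans (hPsum d hd)) hg)).2
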